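/- Consider the curved 3-body problem on the surface M_κ² with κ ≠ 0 and masses m_1, m_2, m_3 > 0. Suppose q = (q_1,q_2,q_3) has the homographic form q_i(t) = (r(t)cos(ω(t)+α_i), r(t)sin(ω(t)+α_i), z(t)) with constants 0 ≤ α_1 < α_2 < α_3 < 2π, size function r(t) > 0, angular function ω(t), and z(t)² = σκ⁻¹ − σ r(t)², and suppose the triangle with vertices q_1, q_2, q_3 is scalene and non-equilateral, i.e., the quantities 1 − cos(α_2−α_1), 1 − cos(α_3−α_2), 1 − cos(α_3−α_1) are pairwise distinct. If κ < 0, then q does not solve the equations of motion q_i'' = Σ_{j≠i} m_j |κ|^{3/2} [q_j − (κ q_i ⊙ q_j) q_i] / [σ − σ(κ q_i ⊙ q_j)²]^{3/2} − (κ q_i' ⊙ q_i') q_i for all t. If κ > 0 and additionally z(t) ≠ 0 for all t (the bodies stay away from the equator), then q does not solve these equations of motion either. -/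

import Mathlib

open Real Finset

/-- The σ-inner product `a ⊙ b = aₓbₓ + a_y b_y + σ a_z b_z` on ℝ³. -/
def odot (σ : ℝ) (a b : Fin 3 → ℝ) : ℝ :=
  a 0 * b 0 + a 1 * b 1 + σ * (a 2 * b 2)

/-- The equations of motion of the curved `n`-body problem on `M_κ²`:
`q_i'' = Σ_{j≠i} m_j |κ|^{3/2} [q_j − (κ q_i ⊙ q_j) q_i] / [σ − σ(κ q_i ⊙ q_j)²]^{3/2}
          − (κ q_i' ⊙ q_i') q_i`. -/
def IsEOMSolution (κ σ : ℝ) (n : ℕ) (m : ℕ → ℝ) (q : ℕ → ℝ → (Fin 3 → ℝ)) : Prop :=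
  ∀ i ∈ Finset.Icc 1 n, ∀ t : ℝ,
    deriv (deriv (q i)) t =
      (∑ j ∈ (Finset.Icc 1 n).erase i,
        (m j * |κ| ^ ((3 : ℝ) / 2) /
            (σ - σ * (κ * odot σ (q i t) (q j t)) ^ 2) ^ ((3 : ℝ) / 2)) •
          (q j t - (κ * odot σ (q i t) (q j t)) • q i t))
      - (κ * odot σ (deriv (q i) t) (deriv (q i) t)) • q i t

/-- Rotation of `ℝ³` about the third axis by the angle `β`. -/
noncomputable def zRotation (β : ℝ) : (Fin 3 → ℝ) →L[ℝ] (Fin 3 → ℝ) :=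
  LinearMap.toContinuousLinearMap
    (Matrix.toLin' !![Real.cos β, -Real.sin β, 0; Real.sin β, Real.cos β, 0; 0, 0, 1])

theorem zRotation_apply (β : ℝ) (v : Fin 3 → ℝ) :
    zRotation β v = ![Real.cos β * v 0 - Real.sin β * v 1,
      Real.sin β * v 0 + Real.cos β * v 1, v 2] := by
  ext k
  fin_cases k <;>
    simp [zRotation, Matrix.mulVec, dotProduct, Fin.sum_univ_three, sub_eq_add_neg]

theorem odot_zRotation (σ β : ℝ) (v w : Fin 3 → ℝ) :
    odot σ (zRotation β v) (zRotation β w) = odot σ v w := by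
  simp only [odot, zRotation_apply, Matrix.cons_val]
  linear_combination (v 0 * w 0 + v 1 * w 1) * Real.sin_sq_add_cos_sq β

theorem deriv_eq_clm_apply_deriv {f g : ℝ → (Fin 3 → ℝ)} (L : (Fin 3 → ℝ) →L[ℝ] (Fin 3 → ℝ))
    (hf : Differentiable ℝ f) (hg : ∀ t, g t = L (f t)) (t : ℝ) :
    deriv g t = L (deriv f t) := by
  rw [funext hg]
  exact (L.hasFDerivAt.comp_hasDerivAt t (hf t).hasDerivAt).deriv

/-- The sines of the central angles `a`, `b`, `2π - a - b` of an inscribed triangle have positive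
sum. -/
theorem sin_add_sin_sub_sin_add_pos {a b : ℝ} (ha : 0 < a) (hb : 0 < b) (hab : a + b < 2 * π) :
    0 < Real.sin a + Real.sin b - Real.sin (a + b) := by
  obtain ⟨x, rfl⟩ : ∃ x, a = 2 * x := ⟨a / 2, by ring⟩
  obtain ⟨y, rfl⟩ : ∃ y, b = 2 * y := ⟨b / 2, by ring⟩
  have hx := Real.sin_pos_of_pos_of_lt_pi (x := x) (by linarith) (by linarith)
  have hy := Real.sin_pos_of_pos_of_lt_pi (x := y) (by linarith) (by linarith)
  have hxy := Real.sin_pos_of_pos_of_lt_pi (x := x + y) (by linarith) (by linarith)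
  have key : Real.sin (2 * x) + Real.sin (2 * y) - Real.sin (2 * x + 2 * y) =
      4 * (Real.sin x * Real.sin y * Real.sin (x + y)) := by
    rw [← mul_add, Real.sin_two_mul, Real.sin_two_mul, Real.sin_two_mul, Real.cos_add,
      Real.sin_add]
    linear_combination
      (-2 * Real.sin y * Real.cos y) * Real.sin_sq_add_cos_sq x +
      (-2 * Real.sin x * Real.cos x) * Real.sin_sq_add_cos_sq y
  rw [key]
  positivity

/-- Balance of the tangential and vertical forces on three bodies forces the three pairwise
interaction weights to coincide. -/
theorem weights_eq_of_balance {a b m₁ m₂ m₃ u v w T Z : ℝ}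
    (hm₁ : 0 < m₁) (hm₂ : 0 < m₂) (hm₃ : 0 < m₃) (hu : 0 < u) (hv : 0 < v) (hw : 0 < w)
    (hS : 0 < Real.sin a + Real.sin b - Real.sin (a + b))
    (hT₁ : m₂ * u * Real.sin a + m₃ * w * Real.sin (a + b) = T)
    (hT₂ : -(m₁ * u * Real.sin a) + m₃ * v * Real.sin b = T)
    (hT₃ : -(m₁ * w * Real.sin (a + b)) - m₂ * v * Real.sin b = T)
    (hZ₁ : m₂ * u * (1 - Real.cos a) + m₃ * w * (1 - Real.cos (a + b)) = Z)
    (hZ₂ : m₁ * u * (1 - Real.cos a) + m₃ * v * (1 - Real.cos b) = Z)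
    (hZ₃ : m₁ * w * (1 - Real.cos (a + b)) + m₂ * v * (1 - Real.cos b) = Z) :
    u = v ∧ v = w := by
  have hT : T = 0 := by
    have : (m₁ + m₂ + m₃) * T = 0 := by
      linear_combination (-m₁) * hT₁ - m₂ * hT₂ - m₃ * hT₃
    exact (mul_eq_zero.1 this).resolve_left (by positivity)
  subst hT
  have hb : Real.sin b ≠ 0 := by
    intro hb
    have h1 : Real.sin a = 0 := by
      have : m₁ * u * Real.sin a = 0 := by rw [hb] at hT₂; linarith
      exact (mul_eq_zero.1 this).resolve_left (by positivity)
    have h2 : Real.sin (a + b) = 0 := by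
      rw [Real.sin_add, h1, hb]; ring
    rw [h1, h2, hb] at hS
    simp at hS
  obtain ⟨l, hl⟩ : ∃ l, m₁ = l * (v * Real.sin b) :=
    ⟨m₁ / (v * Real.sin b), by field_simp⟩
  have hl0 : l ≠ 0 := by
    rintro rfl
    simp at hl
    exact hm₁.ne' hl
  have h₃ : m₃ = l * (u * Real.sin a) := by
    apply mul_left_cancel₀ (mul_ne_zero hv.ne' hb)
    linear_combination hT₂ + u * Real.sin a * hl
  have h₂ : m₂ = -(l * (w * Real.sin (a + b))) := by
    apply mul_left_cancel₀ (mul_ne_zero hv.ne' hb)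
    linear_combination -hT₃ - w * Real.sin (a + b) * hl
  have e₁ : l * (u * w) * (Real.sin a + Real.sin b - Real.sin (a + b)) = Z := by
    rw [← hZ₁, h₂, h₃, Real.cos_add, Real.sin_add]
    linear_combination (-(l * u * w * Real.sin b)) * Real.sin_sq_add_cos_sq a
  have e₂ : l * (u * v) * (Real.sin a + Real.sin b - Real.sin (a + b)) = Z := by
    rw [← hZ₂, hl, h₃, Real.sin_add]
    ring
  have e₃ : l * (v * w) * (Real.sin a + Real.sin b - Real.sin (a + b)) = Z := by
    rw [← hZ₃, hl, h₂, Real.cos_add, Real.sin_add]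
    linear_combination (-(l * v * w * Real.sin a)) * Real.sin_sq_add_cos_sq b
  have c₁ : l * u * (Real.sin a + Real.sin b - Real.sin (a + b)) ≠ 0 :=
    mul_ne_zero (mul_ne_zero hl0 hu.ne') hS.ne'
  have c₂ : l * w * (Real.sin a + Real.sin b - Real.sin (a + b)) ≠ 0 :=
    mul_ne_zero (mul_ne_zero hl0 hw.ne') hS.ne'
  exact ⟨mul_left_cancel₀ c₂ (by linear_combination e₁ - e₃),
    mul_left_cancel₀ c₁ (by linear_combination e₂ - e₁)⟩

/-- The interaction weight determines `d (2 - κ ρ d)`, where `ρ` is the squared radius. -/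
theorem chord_eq_of_weight_eq {κ σ ρ d e p : ℝ} (hp : p ≠ 0) (hκ : κ ≠ 0) (hσ : σ ≠ 0)
    (hρ : ρ ≠ 0) (hd : 0 < σ - σ * (1 - κ * ρ * d) ^ 2)
    (he : 0 < σ - σ * (1 - κ * ρ * e) ^ 2)
    (h : |κ| ^ p / (σ - σ * (1 - κ * ρ * d) ^ 2) ^ p =
      |κ| ^ p / (σ - σ * (1 - κ * ρ * e) ^ 2) ^ p) :
    d * (2 - κ * ρ * d) = e * (2 - κ * ρ * e) := by
  have hk : |κ| ^ p ≠ 0 := (Real.rpow_pos_of_pos (abs_pos.2 hκ) _).ne'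
  rw [div_eq_mul_inv, div_eq_mul_inv, mul_right_inj' hk, inv_inj,
    Real.rpow_left_inj hd.le he.le hp] at h
  apply mul_left_cancel₀ (mul_ne_zero hσ (mul_ne_zero hκ hρ))
  linear_combination h

/-- **No homographic scalene non-equilateral triangles in the curved 3-body problem.**
For `κ < 0` there are no such solutions; for `κ > 0` there are none either,
provided the bodies stay away from the equator (`z(t) ≠ 0`). -/
theorem no_scalene_non_equilateral_homographic_triangles
    (κ : ℝ) (hκ : κ ≠ 0) (σ : ℝ) (hσ : σ = if 0 < κ then 1 else -1)
    (m : ℕ → ℝ) (hm : ∀ i ∈ Finset.Icc 1 3, 0 < m i)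
    (α : ℕ → ℝ)
    (hα0 : 0 ≤ α 1) (hα12 : α 1 < α 2) (hα23 : α 2 < α 3) (hα3 : α 3 < 2 * π)
    (r ω z : ℝ → ℝ)
    (hr : ∀ t, 0 < r t)
    (hz : ∀ t, (z t) ^ 2 = σ * κ⁻¹ - σ * (r t) ^ 2)
    (q : ℕ → ℝ → (Fin 3 → ℝ))
    (hq : ∀ i ∈ Finset.Icc 1 3, ∀ t : ℝ,
      q i t = ![r t * Real.cos (ω t + α i), r t * Real.sin (ω t + α i), z t])
    (hM : ∀ i ∈ Finset.Icc 1 3, ∀ t : ℝ,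
      κ * ((q i t 0) ^ 2 + (q i t 1) ^ 2 + σ * (q i t 2) ^ 2) = 1)
    (hsmooth : ∀ i ∈ Finset.Icc 1 3, ContDiff ℝ 2 (q i))
    (hscalene : (1 - Real.cos (α 2 - α 1)) ≠ (1 - Real.cos (α 3 - α 2)) ∧
                (1 - Real.cos (α 3 - α 2)) ≠ (1 - Real.cos (α 3 - α 1)) ∧
                (1 - Real.cos (α 2 - α 1)) ≠ (1 - Real.cos (α 3 - α 1))) :
    (κ < 0 → ¬ IsEOMSolution κ σ 3 m q) ∧
    (0 < κ → (∀ t : ℝ, z t ≠ 0) → ¬ IsEOMSolution κ σ 3 m q) := by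
  suffices main : (∀ t, z t ≠ 0) → ¬ IsEOMSolution κ σ 3 m q by
    refine ⟨fun hneg => main fun t ht => ?_, fun _ => main⟩
    have h1 := hz t
    rw [if_neg hneg.not_gt] at hσ
    rw [ht, hσ] at h1
    have h2 := inv_lt_zero.2 hneg
    nlinarith [hr t]
  intro hz0 hsol
  have hσ2 : σ * σ = 1 := by rw [hσ]; split_ifs <;> norm_num
  have hσ0 : σ ≠ 0 := fun h => by simp [h] at hσ2
  have hσκ : 0 < σ * κ := by
    rw [hσ]
    split_ifs with h
    · linarith
    · linarith [lt_of_le_of_ne (not_lt.1 h) hκ]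
  have hrad : κ * (r 0) ^ 2 + κ * σ * (z 0) ^ 2 = 1 := by
    rw [hz 0]
    field_simp
    linear_combination (1 - κ * (r 0) ^ 2) * hσ2
  have hρ : 0 < (r 0) ^ 2 := pow_pos (hr 0) 2
  have hlt : κ * (r 0) ^ 2 < 1 := by
    have := mul_pos hσκ (sq_pos_of_ne_zero (hz0 0))
    linarith
  have hodot : ∀ i ∈ Finset.Icc 1 3, ∀ j ∈ Finset.Icc 1 3,
      κ * odot σ (q i 0) (q j 0) = 1 - κ * (r 0) ^ 2 * (1 - Real.cos (α j - α i)) := by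
    intro i hi j hj
    have : Real.cos (α j - α i) = Real.cos ((ω 0 + α j) - (ω 0 + α i)) := by congr 1; ring
    rw [hq i hi, hq j hj, this, Real.cos_sub]
    simp only [odot, Matrix.cons_val]
    linear_combination hrad
  have h1 : (1 : ℕ) ∈ Finset.Icc 1 3 := by decide
  have h2 : (2 : ℕ) ∈ Finset.Icc 1 3 := by decide
  have h3 : (3 : ℕ) ∈ Finset.Icc 1 3 := by decide
  have hrot : ∀ i ∈ Finset.Icc 1 3, ∀ t, q i t = zRotation (α i - α 1) (q 1 t) := by
    intro i hi t
    have : ω t + α i = (α i - α 1) + (ω t + α 1) := by ring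
    rw [zRotation_apply, hq i hi, hq 1 h1, this,
      Real.cos_add (α i - α 1), Real.sin_add (α i - α 1)]
    ext k
    fin_cases k <;> simp <;> ring
  have hd1 : Differentiable ℝ (q 1) := (hsmooth 1 h1).differentiable (by norm_num)
  have hd2 : Differentiable ℝ (deriv (q 1)) := (hsmooth 1 h1).differentiable_deriv_two
  have hv : ∀ i ∈ Finset.Icc 1 3, ∀ t,
      deriv (q i) t = zRotation (α i - α 1) (deriv (q 1) t) := fun i hi =>
    deriv_eq_clm_apply_deriv _ hd1 (hrot i hi)
  have ha : ∀ i ∈ Finset.Icc 1 3, ∀ t,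
      deriv (deriv (q i)) t = zRotation (α i - α 1) (deriv (deriv (q 1)) t) := fun i hi =>
    deriv_eq_clm_apply_deriv _ hd2 (hv i hi)
  set acc := deriv (deriv (q 1)) 0
  set K := κ * odot σ (deriv (q 1) 0) (deriv (q 1) 0)
  set W : ℝ → ℝ := fun d =>
    |κ| ^ ((3 : ℝ) / 2) / (σ - σ * (1 - κ * (r 0) ^ 2 * d) ^ 2) ^ ((3 : ℝ) / 2)
  have heom : ∀ i ∈ Finset.Icc 1 3, zRotation (α i - α 1) acc =
      (∑ j ∈ (Finset.Icc 1 3).erase i, (m j * W (1 - Real.cos (α j - α i))) •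
        (q j 0 - (1 - κ * (r 0) ^ 2 * (1 - Real.cos (α j - α i))) • q i 0)) - K • q i 0 := by
    intro i hi
    rw [← ha i hi, hsol i hi 0, hv i hi, odot_zRotation]
    congr 1
    refine Finset.sum_congr rfl fun j hj => ?_
    rw [hodot i hi j (Finset.mem_of_mem_erase hj), mul_div_assoc]
  have hvert : ∀ i ∈ Finset.Icc 1 3,
      ∑ j ∈ (Finset.Icc 1 3).erase i,
        m j * W (1 - Real.cos (α j - α i)) * (1 - Real.cos (α j - α i)) =
      (acc 2 + K * z 0) / (κ * (r 0) ^ 2 * z 0) := by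
    intro i hi
    have h := congrFun (heom i hi) 2
    rw [zRotation_apply, Pi.sub_apply, Finset.sum_apply] at h
    rw [eq_div_iff (mul_ne_zero (mul_ne_zero hκ hρ.ne') (hz0 0)), Finset.sum_mul]
    have hqz : ∀ j ∈ Finset.Icc 1 3, q j 0 2 = z 0 := fun j hj => by simp [hq j hj]
    simp only [Pi.smul_apply, Pi.sub_apply, smul_eq_mul, Matrix.cons_val, hqz i hi] at h
    rw [h, sub_add_cancel]
    refine Finset.sum_congr rfl fun j hj => ?_
    rw [hqz j (Finset.mem_of_mem_erase hj)]
    ring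
  have htan : ∀ i ∈ Finset.Icc 1 3,
      ∑ j ∈ (Finset.Icc 1 3).erase i,
        m j * W (1 - Real.cos (α j - α i)) * Real.sin (α j - α i) =
      (Real.cos (ω 0 + α 1) * acc 1 - Real.sin (ω 0 + α 1) * acc 0) / r 0 := by
    intro i hi
    have hx := congrFun (heom i hi) 0
    have hy := congrFun (heom i hi) 1
    rw [zRotation_apply, Pi.sub_apply, Finset.sum_apply] at hx hy
    simp only [Pi.smul_apply, Pi.sub_apply, smul_eq_mul, Matrix.cons_val] at hx hy
    have hθ : ω 0 + α 1 = (ω 0 + α i) - (α i - α 1) := by ring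
    have hacc : Real.cos (ω 0 + α 1) * acc 1 - Real.sin (ω 0 + α 1) * acc 0 =
        Real.cos (ω 0 + α i) *
          (Real.sin (α i - α 1) * acc 0 + Real.cos (α i - α 1) * acc 1) -
        Real.sin (ω 0 + α i) *
          (Real.cos (α i - α 1) * acc 0 - Real.sin (α i - α 1) * acc 1) := by
      rw [hθ, Real.cos_sub (ω 0 + α i), Real.sin_sub (ω 0 + α i)]
      ring
    have hqx : ∀ j ∈ Finset.Icc 1 3, q j 0 0 = r 0 * Real.cos (ω 0 + α j) :=
      fun j hj => by simp [hq j hj]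
    have hqy : ∀ j ∈ Finset.Icc 1 3, q j 0 1 = r 0 * Real.sin (ω 0 + α j) :=
      fun j hj => by simp [hq j hj]
    rw [eq_div_iff (hr 0).ne', hacc, hx, hy, hqx i hi, hqy i hi, mul_sub, mul_sub,
      Finset.mul_sum, Finset.mul_sum, sub_sub_sub_comm, ← Finset.sum_sub_distrib,
      Finset.sum_mul]
    rw [show ∀ c s x : ℝ, c * (x * (r 0 * s)) - s * (x * (r 0 * c)) = 0 by intros; ring,
      sub_zero]
    refine Finset.sum_congr rfl fun j hj => ?_
    rw [hqx j (Finset.mem_of_mem_erase hj), hqy j (Finset.mem_of_mem_erase hj)]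
    have hs : Real.sin (α j - α i) = Real.sin ((ω 0 + α j) - (ω 0 + α i)) := by
      congr 1; ring
    rw [hs, Real.sin_sub (ω 0 + α j)]
    ring
  have hne : ∀ x : ℝ, 0 < x → x < 2 * π →
      0 < σ - σ * (1 - κ * (r 0) ^ 2 * (1 - Real.cos x)) ^ 2 := by
    intro x hx0 hx1
    have hc : Real.cos x < 1 := by
      refine lt_of_le_of_ne (Real.cos_le_one x) fun h => hx0.ne' ?_
      exact (Real.cos_eq_one_iff_of_lt_of_lt (by linarith) hx1).1 h
    have hd : 0 < 1 - Real.cos x := by linarith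
    have hd2 : 1 - Real.cos x ≤ 2 := by linarith [Real.neg_one_le_cos x]
    have hpos : 0 < 2 - κ * (r 0) ^ 2 * (1 - Real.cos x) := by nlinarith
    have := mul_pos (mul_pos (mul_pos hσκ hρ) hd) hpos
    linarith
  have hWpos : ∀ x : ℝ, 0 < x → x < 2 * π → 0 < W (1 - Real.cos x) := fun x hx0 hx1 =>
    div_pos (Real.rpow_pos_of_pos (abs_pos.2 hκ) _) (Real.rpow_pos_of_pos (hne x hx0 hx1) _)
  have e1 : (Finset.Icc 1 3).erase 1 = ({2, 3} : Finset ℕ) := by decide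
  have e2 : (Finset.Icc 1 3).erase 2 = ({1, 3} : Finset ℕ) := by decide
  have e3 : (Finset.Icc 1 3).erase 3 = ({1, 2} : Finset ℕ) := by decide
  have v1 := hvert 1 h1
  have v2 := hvert 2 h2
  have v3 := hvert 3 h3
  have t1 := htan 1 h1
  have t2 := htan 2 h2
  have t3 := htan 3 h3
  rw [e1, Finset.sum_pair (by norm_num)] at v1 t1
  rw [e2, Finset.sum_pair (by norm_num)] at v2 t2
  rw [e3, Finset.sum_pair (by norm_num)] at v3 t3
  have hab : α 3 - α 1 = (α 2 - α 1) + (α 3 - α 2) := by ring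
  rw [← neg_sub (α 2) (α 1), Real.cos_neg] at v2 t2
  rw [← neg_sub (α 3) (α 1), ← neg_sub (α 3) (α 2), Real.cos_neg, Real.cos_neg] at v3 t3
  rw [Real.sin_neg] at t2 t3
  rw [Real.sin_neg] at t3
  obtain ⟨hs1, hs2, hs3⟩ := hscalene
  have wa := hne (α 2 - α 1) (by linarith) (by linarith)
  have wb := hne (α 3 - α 2) (by linarith) (by linarith)
  have wc := hne (α 3 - α 1) (by linarith) (by linarith)
  have pa := hWpos (α 2 - α 1) (by linarith) (by linarith)
  have pb := hWpos (α 3 - α 2) (by linarith) (by linarith)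
  have pc := hWpos (α 3 - α 1) (by linarith) (by linarith)
  have hS := sin_add_sin_sub_sin_add_pos (a := α 2 - α 1) (b := α 3 - α 2)
    (by linarith) (by linarith) (by linarith)
  rw [hab] at pc v1 t1 v3 t3
  obtain ⟨huv, hvw⟩ := weights_eq_of_balance (hm 1 h1) (hm 2 h2) (hm 3 h3) pa pb pc hS
    t1 (by linarith) (by linarith) v1 v2 v3
  rw [← hab] at hvw
  have k1 := chord_eq_of_weight_eq (by norm_num) hκ hσ0 hρ.ne' wa wb huv
  have k2 := chord_eq_of_weight_eq (by norm_num) hκ hσ0 hρ.ne' wb wc hvw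
  have l1 := mul_left_cancel₀ (b := κ * (r 0) ^ 2 *
      ((1 - Real.cos (α 2 - α 1)) + (1 - Real.cos (α 3 - α 2)))) (c := 2)
    (sub_ne_zero.2 hs1) (by linear_combination -k1)
  have l2 := mul_left_cancel₀ (b := κ * (r 0) ^ 2 *
      ((1 - Real.cos (α 3 - α 2)) + (1 - Real.cos (α 3 - α 1)))) (c := 2)
    (sub_ne_zero.2 hs2) (by linear_combination -k2)
  exact hs3 (mul_left_cancel₀ (mul_ne_zero hκ hρ.ne') (by linear_combination l1 - l2))
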